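/- Let α > 0 and ξ < 0. For each n ≥ 1 the polynomial A_n has a smallest real zero μ_{1,n}, and μ_{1,n} → 0 as n → ∞. -/

import Mathlib

open Polynomial Filter

/-- The polynomials `A_n(λ)` of the Laguerre case (a):
`A_0 = 1`, `A_1(λ) = λ - α - 1 + ξ - ξ/(ξ-α)`, and for `n ≥ 2`
`A_n(λ) = (λ - 2 + (ξ-α)/n)·A_{n-1}(λ) - (1 + α/(n-1))·A_{n-2}(λ)`. -/
noncomputable def Apoly (α ξ : ℝ) : ℕ → Polynomial ℝ
  | 0 => 1
  | 1 => Polynomial.X - Polynomial.C (α + 1 - ξ + ξ / (ξ - α))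
  | n + 2 =>
      (Polynomial.X - Polynomial.C (2 - (ξ - α) / ((n : ℝ) + 2))) * Apoly α ξ (n + 1) -
        Polynomial.C (1 + α / ((n : ℝ) + 1)) * Apoly α ξ n

/-- The values `(-1)^n A_n(x)`, which are positive for `x ≤ 0`. -/
noncomputable def signedApoly (α ξ : ℝ) (n : ℕ) (x : ℝ) : ℝ :=
  (-1) ^ n * (Apoly α ξ n).eval x

theorem signedApoly_zero (α ξ x : ℝ) : signedApoly α ξ 0 x = 1 := by
  simp [signedApoly, Apoly]

theorem signedApoly_one (α ξ x : ℝ) :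
    signedApoly α ξ 1 x = α + 1 - ξ + ξ / (ξ - α) - x := by
  simp only [signedApoly, Apoly, eval_sub, eval_X, eval_C]
  ring

theorem signedApoly_add_two (α ξ x : ℝ) (n : ℕ) :
    signedApoly α ξ (n + 2) x =
      (2 - x + (α - ξ) / ((n : ℝ) + 2)) * signedApoly α ξ (n + 1) x -
        (1 + α / ((n : ℝ) + 1)) * signedApoly α ξ n x := by
  simp only [signedApoly, Apoly, eval_sub, eval_mul, eval_X, eval_C]
  ring

theorem continuous_signedApoly (α ξ : ℝ) (n : ℕ) : Continuous (signedApoly α ξ n) :=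
  continuous_const.mul (Apoly α ξ n).continuous

theorem signedApoly_eq_zero_iff {α ξ x : ℝ} {n : ℕ} :
    signedApoly α ξ n x = 0 ↔ (Apoly α ξ n).eval x = 0 := by
  simp [signedApoly]

/-- For `x ≤ 0` the ratio of consecutive signed values is at least `1 + α/(n+1)`. -/
theorem signedApoly_pos_and_ratio {α ξ x : ℝ} (hα : 0 < α) (hξ : ξ < 0) (hx : x ≤ 0) (n : ℕ) :
    0 < signedApoly α ξ n x ∧
      (1 + α / ((n : ℝ) + 1)) * signedApoly α ξ n x ≤ signedApoly α ξ (n + 1) x := by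
  induction n with
  | zero =>
    have h : 0 ≤ ξ / (ξ - α) := div_nonneg_of_nonpos hξ.le (by linarith)
    rw [signedApoly_zero, signedApoly_one]
    norm_num
    linarith
  | succ n ih =>
    obtain ⟨h0, h1⟩ := ih
    have hc : 0 < 1 + α / ((n : ℝ) + 1) := by positivity
    have hpos : 0 < signedApoly α ξ (n + 1) x := (mul_pos hc h0).trans_le h1
    refine ⟨hpos, ?_⟩
    rw [signedApoly_add_two]
    have hd : α / ((n : ℝ) + 2) ≤ (α - ξ) / ((n : ℝ) + 2) := by gcongr; linarith
    have hm : (1 + α / ((n : ℝ) + 2)) * signedApoly α ξ (n + 1) x ≤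
        (1 - x + (α - ξ) / ((n : ℝ) + 2)) * signedApoly α ξ (n + 1) x :=
      mul_le_mul_of_nonneg_right (by linarith) hpos.le
    have he : ((n + 1 : ℕ) : ℝ) + 1 = (n : ℝ) + 2 := by push_cast; ring
    rw [he]
    linarith

theorem signedApoly_pos {α ξ x : ℝ} (hα : 0 < α) (hξ : ξ < 0) (hx : x ≤ 0) (n : ℕ) :
    0 < signedApoly α ξ n x :=
  (signedApoly_pos_and_ratio hα hξ hx n).1

theorem exists_isLeast_zero_le {α ξ x : ℝ} {n : ℕ} (hα : 0 < α) (hξ : ξ < 0)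
    (hx : signedApoly α ξ n x ≤ 0) :
    ∃ μ ≤ x, IsLeast {y : ℝ | (Apoly α ξ n).eval y = 0} μ := by
  have hx0 : 0 ≤ x := by
    by_contra! h
    exact (signedApoly_pos hα hξ h.le n).not_ge hx
  obtain ⟨z, hz, hz0⟩ : (0 : ℝ) ∈ signedApoly α ξ n '' Set.Icc 0 x :=
    intermediate_value_Icc' hx0 (continuous_signedApoly α ξ n).continuousOn
      ⟨hx, (signedApoly_pos hα hξ le_rfl n).le⟩
  have hzero : z ∈ {y : ℝ | (Apoly α ξ n).eval y = 0} := signedApoly_eq_zero_iff.1 hz0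
  have hbdd : BddBelow {y : ℝ | (Apoly α ξ n).eval y = 0} := by
    refine ⟨0, fun y hy => ?_⟩
    by_contra! h
    exact (signedApoly_pos hα hξ h.le n).ne' (signedApoly_eq_zero_iff.2 hy)
  have hclosed : IsClosed {y : ℝ | (Apoly α ξ n).eval y = 0} :=
    isClosed_eq (Apoly α ξ n).continuous continuous_const
  exact ⟨_, (csInf_le hbdd hzero).trans hz.2, hclosed.isLeast_csInf ⟨z, hzero⟩ hbdd⟩

theorem exists_signedApoly_succ_nonpos {α ξ : ℝ} (hα : 0 < α) (hξ : ξ < 0) (n : ℕ) :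
    ∀ x, signedApoly α ξ n x ≤ 0 → ∃ z ≤ x, signedApoly α ξ (n + 1) z ≤ 0 := by
  induction n with
  | zero =>
    intro x hx
    rw [signedApoly_zero] at hx
    linarith
  | succ n ih =>
    intro x hx
    obtain ⟨μ, hμx, hμ⟩ := exists_isLeast_zero_le hα hξ hx
    have hμ0 : signedApoly α ξ (n + 1) μ = 0 := signedApoly_eq_zero_iff.2 hμ.1
    have hn : 0 ≤ signedApoly α ξ n μ := by
      by_contra! h
      obtain ⟨z, hzμ, hz⟩ := exists_isLeast_zero_le hα hξ h.le
      have hz0 : signedApoly α ξ n z = 0 := signedApoly_eq_zero_iff.2 hz.1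
      have hlt : z < μ := lt_of_le_of_ne hzμ (by rintro rfl; exact h.ne hz0)
      obtain ⟨w, hwz, hw⟩ := ih z hz0.le
      obtain ⟨v, hvw, hv⟩ := exists_isLeast_zero_le hα hξ hw
      linarith [hμ.2 hv.1]
    refine ⟨μ, hμx, ?_⟩
    rw [signedApoly_add_two, hμ0]
    have : 0 ≤ (1 + α / ((n : ℝ) + 1)) * signedApoly α ξ n μ := by positivity
    linarith

theorem exists_signedApoly_nonpos_of_le {α ξ x : ℝ} (hα : 0 < α) (hξ : ξ < 0) {m n : ℕ}
    (hmn : m ≤ n) (hx : signedApoly α ξ m x ≤ 0) : ∃ z ≤ x, signedApoly α ξ n z ≤ 0 := by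
  induction n, hmn using Nat.le_induction with
  | base => exact ⟨x, le_rfl, hx⟩
  | succ n _ ih =>
    obtain ⟨z, hzx, hz⟩ := ih
    obtain ⟨w, hwz, hw⟩ := exists_signedApoly_succ_nonpos hα hξ n z hz
    exact ⟨w, hwz.trans hzx, hw⟩

/-- If all signed values at `ε > 0` were positive, their consecutive ratios would eventually
decrease by at least `ε / 2` at each step. -/
theorem exists_signedApoly_nonpos {α ξ ε : ℝ} (hα : 0 < α) (hε : 0 < ε) :
    ∃ n, signedApoly α ξ n ε ≤ 0 := by
  by_contra! h
  obtain ⟨N, hN⟩ := exists_nat_gt ((α - ξ) / (ε / 2))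
  have hstep : ∀ n, N ≤ n →
      signedApoly α ξ (n + 2) ε / signedApoly α ξ (n + 1) ε ≤
        signedApoly α ξ (n + 1) ε / signedApoly α ξ n ε - ε / 2 := by
    intro n hn
    have hNn : (N : ℝ) ≤ n := by exact_mod_cast hn
    have hsmall : (α - ξ) / ((n : ℝ) + 2) ≤ ε / 2 := by
      rw [div_lt_iff₀ (by positivity)] at hN
      rw [div_le_iff₀ (by positivity)]
      nlinarith
    have ha := h n
    have hb := h (n + 1)
    have hc : 0 ≤ α / ((n : ℝ) + 1) := by positivity
    have hrec := signedApoly_add_two α ξ ε n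
    set a := signedApoly α ξ n ε
    set b := signedApoly α ξ (n + 1) ε
    have h1 : signedApoly α ξ (n + 2) ε ≤ (2 - ε / 2) * b - a := by
      rw [hrec]
      nlinarith [mul_le_mul_of_nonneg_right hsmall hb.le, mul_nonneg hc ha.le]
    have h2 : (2 - ε / 2) * b - a ≤ (b / a - ε / 2) * b := by
      have : (b / a - ε / 2) * b - ((2 - ε / 2) * b - a) = (b - a) ^ 2 / a := by
        field_simp
        ring
      have : 0 ≤ (b - a) ^ 2 / a := by positivity
      linarith
    rw [div_le_iff₀ hb]
    exact h1.trans h2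
  have hdecay : ∀ k : ℕ, signedApoly α ξ (N + k + 1) ε / signedApoly α ξ (N + k) ε ≤
      signedApoly α ξ (N + 1) ε / signedApoly α ξ N ε - k * (ε / 2) := by
    intro k
    induction k with
    | zero => simp
    | succ k ih =>
      have := hstep (N + k) (Nat.le_add_right N k)
      have he : N + (k + 1) = N + k + 1 := rfl
      rw [he]
      push_cast
      linarith
  obtain ⟨k, hk⟩ :=
    exists_nat_gt (signedApoly α ξ (N + 1) ε / signedApoly α ξ N ε / (ε / 2))
  rw [div_lt_iff₀ (by positivity)] at hk
  have := div_pos (h (N + k + 1)) (h (N + k))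
  linarith [hdecay k]

theorem stmt3 (α ξ : ℝ) (hα : 0 < α) (hξ : ξ < 0) :
    (∀ n : ℕ, 1 ≤ n → ∃ μ : ℝ, IsLeast {x : ℝ | (Apoly α ξ n).eval x = 0} μ) ∧
    ∀ μ : ℕ → ℝ, (∀ n : ℕ, 1 ≤ n → IsLeast {x : ℝ | (Apoly α ξ n).eval x = 0} (μ n)) →
      Tendsto μ atTop (nhds 0) := by
  constructor
  · intro n hn
    have h1 : signedApoly α ξ 1 (α + 1 - ξ + ξ / (ξ - α)) ≤ 0 := by
      rw [signedApoly_one, sub_self]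
    obtain ⟨z, -, hz⟩ := exists_signedApoly_nonpos_of_le hα hξ hn h1
    obtain ⟨μ, -, hμ⟩ := exists_isLeast_zero_le hα hξ hz
    exact ⟨μ, hμ⟩
  · intro μ hμ
    rw [Metric.tendsto_atTop]
    intro ε hε
    obtain ⟨N, hN⟩ := exists_signedApoly_nonpos (ξ := ξ) hα (half_pos hε)
    refine ⟨max N 1, fun n hn => ?_⟩
    have hleast := hμ n ((le_max_right N 1).trans hn)
    have hpos : 0 < μ n := by
      by_contra! h
      exact (signedApoly_pos hα hξ h n).ne' (signedApoly_eq_zero_iff.2 hleast.1)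
    obtain ⟨z, hzε, hz⟩ := exists_signedApoly_nonpos_of_le hα hξ ((le_max_left N 1).trans hn) hN
    obtain ⟨ν, hνz, hν⟩ := exists_isLeast_zero_le hα hξ hz
    rw [Real.dist_eq, sub_zero, abs_of_pos hpos]
    linarith [hleast.2 hν.1]
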